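/- For every integer n ≥ 1 and all positive integers n_1, n_2, Alice has a winning strategy in the achievement game (S_{n,n}, K_{n_1,n_2}, +) if and only if min{n_1, n_2} ≥ 2n + 1. -/

import Mathlib

namespace AchievementGame

/-- A strategy for the achievement game: given the history of all moves played so far
(earliest first), produce the next move (an edge, i.e. an element of `Sym2`). -/
def Strategy (α : Type*) : Type _ := List (Sym2 α) → Sym2 α

/-- A strategy is valid for the host graph `G` if, whenever some edge of `G` is still
uncolored, it chooses an uncolored edge of `G`. -/
def Strategy.Valid {α : Type*} (G : SimpleGraph α) (s : Strategy α) : Prop :=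
  ∀ l : List (Sym2 α), (∃ e ∈ G.edgeSet, e ∉ l) → s l ∈ G.edgeSet ∧ s l ∉ l

/-- The history of the first `n` moves when Alice plays strategy `σ` and Bob plays
strategy `τ`; Alice moves first and the players alternate. -/
def hist {α : Type*} (σ τ : Strategy α) : ℕ → List (Sym2 α)
  | 0 => []
  | n + 1 => hist σ τ n ++ [(if n % 2 = 0 then σ else τ) (hist σ τ n)]

/-- The `n`-th move (0-indexed): even indices are Alice's (blue) moves,
odd indices are Bob's (red) moves. -/
def move {α : Type*} (σ τ : Strategy α) (n : ℕ) : Sym2 α :=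
  (if n % 2 = 0 then σ else τ) (hist σ τ n)

/-- The set `s` of edges contains a copy of the graph `F`. -/
def HasCopy {α β : Type*} (F : SimpleGraph β) (s : Set (Sym2 α)) : Prop :=
  ∃ f : β ↪ α, ∀ a b, F.Adj a b → s(f a, f b) ∈ s

/-- Alice has a winning strategy in the achievement game `(F, G, +)`: Alice has a valid
strategy such that against every valid strategy of Bob, at some legal move of Alice
(her `(k+1)`-st move, which exists since `2k+1 ≤ |E(G)|`) the blue edges contain a copy
of `F`, while the red edges played strictly before do not. -/
def AliceWins {α β : Type*} (F : SimpleGraph β) (G : SimpleGraph α) : Prop :=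
  ∃ σ : Strategy α, Strategy.Valid G σ ∧ ∀ τ : Strategy α, Strategy.Valid G τ →
    ∃ k : ℕ, 2 * k + 1 ≤ G.edgeSet.ncard ∧
      HasCopy F {e | ∃ i ≤ k, e = move σ τ (2 * i)} ∧
      ¬ HasCopy F {e | ∃ i < k, e = move σ τ (2 * i + 1)}

/-- The matching `mK₂` consisting of `m` pairwise disjoint edges. -/
def matching (m : ℕ) : SimpleGraph (Fin m ⊕ Fin m) :=
  SimpleGraph.fromRel (fun a b => ∃ i, a = Sum.inl i ∧ b = Sum.inr i)

/-- The star `K_{1,m}`: the center `0` joined to `m` leaves. -/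
def star (m : ℕ) : SimpleGraph (Fin (m + 1)) :=
  SimpleGraph.fromRel (fun a _ => a = 0)

/-- The double star `S_{m,n}`: disjoint stars `K_{1,m}` and `K_{1,n}` with an edge
joining their centers `Sum.inl 0` and `Sum.inr 0`. -/
def doubleStar (m n : ℕ) : SimpleGraph (Fin (m + 1) ⊕ Fin (n + 1)) :=
  SimpleGraph.fromRel (fun a b =>
    (a = Sum.inl 0 ∧ ∃ i, b = Sum.inl i) ∨
    (a = Sum.inr 0 ∧ ∃ j, b = Sum.inr j) ∨
    (a = Sum.inl 0 ∧ b = Sum.inr 0))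

/-- The disjoint union `K_{1,m} ∪ nK₂` of a star and a matching. -/
def starMatching (m n : ℕ) : SimpleGraph (Fin (m + 1) ⊕ (Fin n ⊕ Fin n)) :=
  SimpleGraph.fromRel (fun a b =>
    (a = Sum.inl 0 ∧ ∃ i, b = Sum.inl i) ∨
    (∃ i, a = Sum.inr (Sum.inl i) ∧ b = Sum.inr (Sum.inr i)))

end AchievementGame

namespace AchievementGame

section General
variable {α : Type*}

lemma hist_succ (σ τ : Strategy α) (m : ℕ) : hist σ τ (m+1) = hist σ τ m ++ [move σ τ m] := rfl

lemma hist_length (σ τ : Strategy α) (m : ℕ) : (hist σ τ m).length = m := by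
  induction m with
  | zero => rfl
  | succ k ih => simp [hist_succ, ih]

lemma mem_hist {σ τ : Strategy α} {m : ℕ} {e : Sym2 α} :
    e ∈ hist σ τ m ↔ ∃ j < m, move σ τ j = e := by
  induction m with
  | zero => simp [hist]
  | succ k ih =>
    rw [hist_succ, List.mem_append, ih, List.mem_singleton]
    constructor
    · rintro (⟨j, hj, h⟩ | h)
      · exact ⟨j, by omega, h⟩
      · exact ⟨k, by omega, h.symm⟩
    · rintro ⟨j, hj, h⟩
      rcases Nat.lt_succ_iff_lt_or_eq.mp hj with h' | rfl
      · exact Or.inl ⟨j, h', h⟩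
      · exact Or.inr h.symm

lemma exists_free {E : Set (Sym2 α)} (l : List (Sym2 α)) (h : l.length < E.ncard) :
    ∃ e ∈ E, e ∉ l := by
  classical
  by_contra! hc
  have h1 : E ⊆ (l.toFinset : Set (Sym2 α)) := fun e he => by simpa using hc e he
  have h2 := Set.ncard_le_ncard h1 (Finset.finite_toSet _)
  rw [Set.ncard_coe_finset] at h2
  have := l.toFinset_card_le
  omega

lemma move_valid {G : SimpleGraph α} {σ τ : Strategy α} (hσ : σ.Valid G) (hτ : τ.Valid G)
    {m : ℕ} (hm : m < G.edgeSet.ncard) :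
    move σ τ m ∈ G.edgeSet ∧ move σ τ m ∉ hist σ τ m := by
  have := exists_free (hist σ τ m) (by rwa [hist_length])
  unfold move
  split_ifs
  · exact hσ _ this
  · exact hτ _ this

open Classical in
/-- Bob answers in the same class as the last move whenever possible. -/
noncomputable def bobStrat (G : SimpleGraph α) (R : Sym2 α → Sym2 α → Prop) (d : Sym2 α) :
    Strategy α := fun l =>
  if h : ∃ e, e ∈ G.edgeSet ∧ e ∉ l ∧ ∃ x, l.getLast? = some x ∧ R x e then h.choose
  else if h : ∃ e ∈ G.edgeSet, e ∉ l then h.choose else d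

lemma bobStrat_valid (G : SimpleGraph α) (R) (d) : (bobStrat G R d).Valid G := by
  intro l hl
  unfold bobStrat
  split_ifs with h
  · exact ⟨h.choose_spec.1, h.choose_spec.2.1⟩
  · exact hl.choose_spec

lemma bob_draws {β : Type*} (F : SimpleGraph β) (G : SimpleGraph α) (d : Sym2 α)
    (R : Sym2 α → Sym2 α → Prop)
    (hsymm : ∀ x y, R x y → R y x)
    (hR : ∀ x y z, R x y → R x z → y ≠ x → z ≠ x → y = z)
    (hF : ∀ B ⊆ G.edgeSet, HasCopy F B → ∃ x ∈ B, ∃ y ∈ B, x ≠ y ∧ R x y) :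
    ¬ AliceWins F G := by
  rintro ⟨σ, hσ, H⟩
  set τ := bobStrat G R d with hτdef
  have hτ : τ.Valid G := bobStrat_valid G R d
  obtain ⟨k, hk, hc, -⟩ := H τ hτ
  have key : ∀ i j, i < j → j ≤ k → ¬ R (move σ τ (2*i)) (move σ τ (2*j)) := by
    intro i j hij hj hr
    have hvj := move_valid hσ hτ (m := 2*j) (by omega)
    have hvi := move_valid hσ hτ (m := 2*i+1) (by omega)
    have hnot : ∀ t < 2*j, move σ τ t ≠ move σ τ (2*j) := fun t ht h =>
      hvj.2 (mem_hist.2 ⟨t, ht, h⟩)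
    have hex : ∃ e, e ∈ G.edgeSet ∧ e ∉ hist σ τ (2*i+1) ∧
        ∃ x, (hist σ τ (2*i+1)).getLast? = some x ∧ R x e := by
      refine ⟨move σ τ (2*j), hvj.1, ?_, move σ τ (2*i), by simp [hist_succ], hr⟩
      intro h
      obtain ⟨t, ht, h⟩ := mem_hist.1 h
      exact hnot t (by omega) h
    have hm : move σ τ (2*i+1) = hex.choose := by
      have : (2*i+1) % 2 ≠ 0 := by omega
      rw [move, if_neg this]
      exact dif_pos hex
    obtain ⟨-, h2, x, hx, hrx⟩ := hex.choose_spec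
    rw [← hm] at h2 hrx
    have hx' : x = move σ τ (2*i) := by
      simp [hist_succ] at hx
      exact hx.symm
    subst hx'
    refine hnot (2*i+1) (by omega) (hR _ _ _ hrx hr ?_ ?_)
    · intro h
      exact h2 (mem_hist.2 ⟨2*i, by omega, h.symm⟩)
    · exact fun h => hnot (2*i) (by omega) h.symm
  obtain ⟨x, ⟨i, hi, rfl⟩, y, ⟨j, hj, rfl⟩, hne, hr⟩ := hF _ (by
    rintro e ⟨i, hi, rfl⟩
    exact (move_valid hσ hτ (m := 2*i) (by omega)).1) hc
  rcases lt_trichotomy i j with h | h | h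
  · exact key i j h hj hr
  · exact hne (by rw [h])
  · exact key j i h hi (hsymm _ _ hr)

open Classical in
/-- Alice's pairing strategy: start with `e0`, answer in the pair of the last move if possible,
otherwise open a new pair. -/
noncomputable def aliceStrat {I : Type*} (G : SimpleGraph α) (e0 : Sym2 α)
    (p : I → Bool → Sym2 α) : Strategy α := fun l =>
  if l = [] then e0
  else if h : ∃ q : I × Bool, l.getLast? = some (p q.1 q.2) ∧ p q.1 (!q.2) ∉ l then
    p h.choose.1 (!h.choose.2)
  else if h : ∃ i, ∀ c, p i c ∉ l then p h.choose false
  else if h : ∃ e ∈ G.edgeSet, e ∉ l then h.choose else e0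

lemma aliceStrat_valid {I : Type*} (G : SimpleGraph α) (e0 : Sym2 α)
    (p : I → Bool → Sym2 α) (h0 : e0 ∈ G.edgeSet) (hp : ∀ i c, p i c ∈ G.edgeSet) :
    (aliceStrat G e0 p).Valid G := by
  intro l hl
  unfold aliceStrat
  split_ifs with h1 h2 h3
  · subst h1; simpa using h0
  · exact ⟨hp _ _, h2.choose_spec.2⟩
  · exact ⟨hp _ _, h3.choose_spec _⟩
  · exact hl.choose_spec

lemma alice_gets {I : Type*} [Fintype I] (G : SimpleGraph α) (e0 : Sym2 α)
    (p : I → Bool → Sym2 α) (h0 : e0 ∈ G.edgeSet) (hp : ∀ i c, p i c ∈ G.edgeSet)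
    (hinj : ∀ i c j d, p i c = p j d → i = j ∧ c = d) (hne : ∀ i c, p i c ≠ e0)
    (hcard : 2 * Fintype.card I + 1 ≤ G.edgeSet.ncard)
    (τ : Strategy α) (hτ : τ.Valid G) :
    move (aliceStrat G e0 p) τ 0 = e0 ∧
    ∀ i, ∃ c, ∃ j ≤ Fintype.card I, p i c = move (aliceStrat G e0 p) τ (2 * j) := by
  classical
  set σ := aliceStrat G e0 p with hσdef
  have hσ : σ.Valid G := aliceStrat_valid G e0 p h0 hp
  have hm0 : move σ τ 0 = e0 := by simp [move, hist, hσdef, aliceStrat]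
  refine ⟨hm0, ?_⟩
  let A : ℕ → Finset I := fun k =>
    Finset.univ.filter fun i => ∃ c, ∃ j ≤ k, p i c = move σ τ (2 * j)
  have hA : ∀ k i, i ∈ A k ↔ ∃ c, ∃ j ≤ k, p i c = move σ τ (2 * j) := by simp [A]
  have main : ∀ k ≤ Fintype.card I, k ≤ (A k).card ∧
      ∀ i ∉ A k, ∀ c, p i c ∉ hist σ τ (2*k+1) := by
    intro k
    induction k with
    | zero =>
      intro _
      refine ⟨Nat.zero_le _, fun i _ c => ?_⟩
      rw [mem_hist]
      rintro ⟨j, hj, h⟩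
      obtain rfl : j = 0 := by omega
      exact hne i c (h.symm.trans hm0)
    | succ k ih =>
      intro hk
      obtain ⟨ih1, ih2⟩ := ih (by omega)
      have hsub : A k ⊆ A (k+1) := by
        intro i hi
        rw [hA] at hi ⊢
        obtain ⟨c, j, hj, h⟩ := hi
        exact ⟨c, j, by omega, h⟩
      have hvb := move_valid hσ hτ (m := 2*k+1) (by omega)
      -- it suffices to find the new pair
      have suff : ∀ i c, i ∉ A k → move σ τ (2*(k+1)) = p i c →
          (∀ j d, move σ τ (2*k+1) = p j d → j ∉ A k → j = i) →
          k + 1 ≤ (A (k+1)).card ∧ ∀ i ∉ A (k+1), ∀ c, p i c ∉ hist σ τ (2*(k+1)+1) := by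
        intro i c hi hmv hb
        have hi' : i ∈ A (k+1) := (hA _ _).2 ⟨c, k+1, le_rfl, hmv.symm⟩
        constructor
        · have h1 : insert i (A k) ⊆ A (k+1) := Finset.insert_subset hi' hsub
          have h2 := Finset.card_le_card h1
          rw [Finset.card_insert_of_notMem hi] at h2
          omega
        · intro j hj d hmem
          have hj' : j ∉ A k := fun h => hj (hsub h)
          have hji : j ≠ i := fun h => hj (h ▸ hi')
          rw [hist_succ, show 2*(k+1) = (2*k+1)+1 by ring, hist_succ] at hmem
          simp only [List.mem_append, List.mem_singleton] at hmem
          rcases hmem with (h | h) | h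
          · exact ih2 j hj' d h
          · exact hji (hb j d h.symm hj')
          · rw [show (2*k+1)+1 = 2*(k+1) by ring, hmv] at h
            exact hji (hinj _ _ _ _ h).1
      have hmv : move σ τ (2*(k+1)) = σ (hist σ τ (2*(k+1))) := by
        simp [move]
      have hne' : hist σ τ (2*(k+1)) ≠ [] := by
        rw [← List.length_pos_iff, hist_length]; omega
      have hh : hist σ τ (2*(k+1)) = hist σ τ (2*k+1) ++ [move σ τ (2*k+1)] := hist_succ _ _ _
      have hlast : (hist σ τ (2*(k+1))).getLast? = some (move σ τ (2*k+1)) := by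
        simp [hh]
      by_cases h1 : ∃ q : I × Bool, (hist σ τ (2*(k+1))).getLast? = some (p q.1 q.2) ∧
          p q.1 (!q.2) ∉ hist σ τ (2*(k+1))
      · have hmv2 : move σ τ (2*(k+1)) = p h1.choose.1 (!h1.choose.2) := by
          exact hmv.trans ((if_neg hne').trans (dif_pos h1))
        obtain ⟨hq1, hq2⟩ := h1.choose_spec
        generalize h1.choose = q at hmv2 hq1 hq2
        rw [hlast, Option.some.injEq] at hq1
        refine suff q.1 (!q.2) ?_ hmv2 ?_
        · intro hq
          obtain ⟨c, j, hj, h⟩ := (hA _ _).1 hq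
          by_cases hc : c = q.2
          · subst hc
            exact hvb.2 (mem_hist.2 ⟨2*j, by omega, by rw [← h, hq1]⟩)
          · have : c = !q.2 := Bool.eq_not.2 hc
            subst this
            exact hq2 (mem_hist.2 ⟨2*j, by omega, h.symm⟩)
        · intro j d hjd _
          rw [hq1] at hjd
          exact (hinj _ _ _ _ hjd).1.symm
      · by_cases hu : A k = Finset.univ
        · have hu' : A (k+1) = Finset.univ := by
            rw [hu] at hsub
            exact Finset.univ_subset_iff.1 hsub
          rw [hu']
          exact ⟨by simpa using hk, fun i hi => absurd (Finset.mem_univ i) hi⟩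
        · have hb : ∀ j d, j ∉ A k → move σ τ (2*k+1) ≠ p j d := by
            intro j d hj h
            refine h1 ⟨(j, d), by rw [hlast, h], ?_⟩
            rw [hh, List.mem_append, List.mem_singleton]
            rintro (h' | h')
            · exact ih2 j hj _ h'
            · rw [h] at h'
              have h3 := (hinj _ _ _ _ h').2
              clear * - h3
              cases d <;> simp at h3
          have h2 : ∃ i, ∀ c, p i c ∉ hist σ τ (2*(k+1)) := by
            obtain ⟨i, hi⟩ : ∃ i, i ∉ A k := by
              by_contra! hc
              exact hu (Finset.eq_univ_iff_forall.2 hc)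
            refine ⟨i, fun c => ?_⟩
            rw [hh, List.mem_append, List.mem_singleton]
            rintro (h' | h')
            · exact ih2 i hi _ h'
            · exact hb i c hi h'.symm
          have hmv2 : move σ τ (2*(k+1)) = p h2.choose false := by
            exact hmv.trans ((if_neg hne').trans ((dif_neg h1).trans (dif_pos h2)))
          have hs := h2.choose_spec
          generalize h2.choose = i at hmv2 hs
          refine suff i false ?_ hmv2 ?_
          · intro hi
            obtain ⟨c, j, hj, h⟩ := (hA _ _).1 hi
            exact hs c (mem_hist.2 ⟨2*j, by omega, h.symm⟩)
          · intro j d h hj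
            exact absurd h (hb j d hj)
  intro i
  have h1 := (main _ le_rfl).1
  have h2 : A (Fintype.card I) = Finset.univ :=
    Finset.eq_univ_of_card _ (le_antisymm (Finset.card_le_univ _) h1)
  exact (hA _ i).1 (h2 ▸ Finset.mem_univ i)

end General

section Double

lemma ds_ll (n : ℕ) (j : Fin n) : (doubleStar n n).Adj (Sum.inl 0) (Sum.inl j.succ) := by
  simp [doubleStar, SimpleGraph.fromRel_adj, Fin.succ_ne_zero, Ne.symm (Fin.succ_ne_zero _)]

lemma ds_rr (n : ℕ) (j : Fin n) : (doubleStar n n).Adj (Sum.inr 0) (Sum.inr j.succ) := by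
  simp [doubleStar, SimpleGraph.fromRel_adj, Fin.succ_ne_zero, Ne.symm (Fin.succ_ne_zero _)]

lemma ds_lr (n : ℕ) : (doubleStar n n).Adj (Sum.inl 0) (Sum.inr 0) := by
  simp [doubleStar, SimpleGraph.fromRel_adj]

/-- An enumeration of the edges of the double star. -/
def dsEdge (n : ℕ) : Option (Fin n ⊕ Fin n) → Sym2 (Fin (n+1) ⊕ Fin (n+1))
  | none => s(Sum.inl 0, Sum.inr 0)
  | some (Sum.inl j) => s(Sum.inl 0, Sum.inl j.succ)
  | some (Sum.inr j) => s(Sum.inr 0, Sum.inr j.succ)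

lemma dsEdge_inj (n : ℕ) : Function.Injective (dsEdge n) := by
  rintro (_ | i | i) (_ | j | j) h <;>
    simp [dsEdge, Fin.succ_ne_zero, Ne.symm (Fin.succ_ne_zero _)] at h ⊢ <;> exact h

lemma copy_card {α : Type*} (n : ℕ) (B : Set (Sym2 α)) (hB : B.Finite)
    (h : HasCopy (doubleStar n n) B) : 2 * n + 1 ≤ B.ncard := by
  obtain ⟨f, hf⟩ := h
  have hinj : Function.Injective (fun o => Sym2.map f (dsEdge n o)) :=
    (Sym2.map.injective f.injective).comp (dsEdge_inj n)
  have h1 : Set.range (fun o => Sym2.map f (dsEdge n o)) ⊆ B := by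
    rintro _ ⟨_ | i | i, rfl⟩
    · exact hf _ _ (ds_lr n)
    · exact hf _ _ (ds_ll n i)
    · exact hf _ _ (ds_rr n i)
  have h2 := Set.ncard_le_ncard h1 hB
  rw [Set.ncard_range_of_injective hinj] at h2
  simp at h2
  omega

lemma copy_centers {α : Type*} (n : ℕ) (B : Set (Sym2 α)) (h : HasCopy (doubleStar n n) B) :
    ∃ (x y : α) (g g' : Fin (n+1) ↪ α), s(x, y) ∈ B ∧
      (∀ i, s(x, g i) ∈ B) ∧ (∀ i, s(y, g' i) ∈ B) := by
  obtain ⟨f, hf⟩ := h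
  have i1 : Function.Injective
      (Fin.cases (Sum.inr 0) (fun j => Sum.inl j.succ) : Fin (n+1) → Fin (n+1) ⊕ Fin (n+1)) := by
    intro i j
    refine Fin.cases ?_ (fun i => ?_) i <;> refine Fin.cases ?_ (fun j => ?_) j <;> simp
  have i2 : Function.Injective
      (Fin.cases (Sum.inl 0) (fun j => Sum.inr j.succ) : Fin (n+1) → Fin (n+1) ⊕ Fin (n+1)) := by
    intro i j
    refine Fin.cases ?_ (fun i => ?_) i <;> refine Fin.cases ?_ (fun j => ?_) j <;> simp
  refine ⟨f (Sum.inl 0), f (Sum.inr 0), ⟨_, f.injective.comp i1⟩, ⟨_, f.injective.comp i2⟩,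
    hf _ _ (ds_lr n), fun i => ?_, fun i => ?_⟩
  · refine Fin.cases ?_ (fun i => ?_) i
    · exact hf _ _ (ds_lr n)
    · exact hf _ _ (ds_ll n i)
  · refine Fin.cases ?_ (fun i => ?_) i
    · exact hf _ _ (ds_lr n).symm
    · exact hf _ _ (ds_rr n i)

/-- A set of edges of the complete bipartite graph with a copy of the double star has a vertex of
large degree on each side. -/
lemma copy_sides (n n₁ n₂ : ℕ) (B : Set (Sym2 (Fin n₁ ⊕ Fin n₂)))
    (hB : B ⊆ (completeBipartiteGraph (Fin n₁) (Fin n₂)).edgeSet)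
    (h : HasCopy (doubleStar n n) B) :
    (∃ (a : Fin n₁) (g : Fin (n+1) ↪ Fin n₂), ∀ i, s(Sum.inl a, Sum.inr (g i)) ∈ B) ∧
    (∃ (b : Fin n₂) (g : Fin (n+1) ↪ Fin n₁), ∀ i, s(Sum.inl (g i), Sum.inr b) ∈ B) := by
  have hl : ∀ (a : Fin n₁) (g : Fin (n+1) ↪ Fin n₁ ⊕ Fin n₂), (∀ i, s(Sum.inl a, g i) ∈ B) →
      (∃ (a : Fin n₁) (g : Fin (n+1) ↪ Fin n₂), ∀ i, s(Sum.inl a, Sum.inr (g i)) ∈ B) := by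
    intro a g hg
    have : ∀ i, ∃ b, g i = Sum.inr b := by
      intro i
      have := hB (hg i)
      rcases hgi : g i with c | c
      · simp [hgi] at this
      · exact ⟨c, rfl⟩
    choose g' hg' using this
    refine ⟨a, ⟨g', fun i j hij => g.injective (by rw [hg', hg', hij])⟩, fun i => ?_⟩
    have := hg i
    rw [hg'] at this
    exact this
  have hr : ∀ (b : Fin n₂) (g : Fin (n+1) ↪ Fin n₁ ⊕ Fin n₂), (∀ i, s(Sum.inr b, g i) ∈ B) →
      (∃ (b : Fin n₂) (g : Fin (n+1) ↪ Fin n₁), ∀ i, s(Sum.inl (g i), Sum.inr b) ∈ B) := by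
    intro a g hg
    have : ∀ i, ∃ b, g i = Sum.inl b := by
      intro i
      have := hB (hg i)
      rcases hgi : g i with c | c
      · exact ⟨c, rfl⟩
      · simp [hgi] at this
    choose g' hg' using this
    refine ⟨a, ⟨g', fun i j hij => g.injective (by rw [hg', hg', hij])⟩, fun i => ?_⟩
    have := hg i
    rw [hg', Sym2.eq_swap] at this
    exact this
  obtain ⟨x, y, g, g', hxy, hg, hg'⟩ := copy_centers n B h
  have := hB hxy
  rcases x with a | a <;> rcases y with b | b
  · simp at this
  · exact ⟨hl a g hg, hr b g' hg'⟩
  · exact ⟨hl b g' hg', hr a g hg⟩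
  · simp at this

lemma pigeon (n m : ℕ) (hm : m ≤ 2 * n) (g : Fin (n+1) ↪ Fin m) :
    ∃ i j, g i ≠ g j ∧ (g i : ℕ) / 2 = (g j : ℕ) / 2 := by
  obtain ⟨i, j, hij, h⟩ := Fintype.exists_ne_map_eq_of_card_lt
    (fun i : Fin (n+1) => (⟨(g i : ℕ) / 2, by have := (g i).2; omega⟩ : Fin n)) (by simp)
  exact ⟨i, j, fun h => hij (g.injective h), by simpa using h⟩

end Double

end AchievementGame

open AchievementGame

/-- For every integer `n ≥ 1` and all positive integers `n₁, n₂`, Alice has a winning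
strategy in the achievement game `(S_{n,n}, K_{n₁,n₂}, +)` if and only if
`min {n₁, n₂} ≥ 2n + 1`. -/
theorem stmt5 (n n₁ n₂ : ℕ) (hn : 1 ≤ n) (h₁ : 1 ≤ n₁) (h₂ : 1 ≤ n₂) :
    AliceWins (doubleStar n n) (completeBipartiteGraph (Fin n₁) (Fin n₂)) ↔
      2 * n + 1 ≤ min n₁ n₂ := by
  constructor
  · intro hw
    by_contra hlt
    have hor : n₁ ≤ 2 * n ∨ n₂ ≤ 2 * n := by omega
    have d : Sym2 (Fin n₁ ⊕ Fin n₂) := s(Sum.inl ⟨0, h₁⟩, Sum.inl ⟨0, h₁⟩)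
    rcases hor with h | h
    · refine bob_draws _ _ d (fun x y => ∃ (a a' : Fin n₁) (b : Fin n₂),
        x = s(Sum.inl a, Sum.inr b) ∧ y = s(Sum.inl a', Sum.inr b) ∧ (a : ℕ) / 2 = (a' : ℕ) / 2)
        ?_ ?_ ?_ hw
      · rintro x y ⟨a, a', b, hx, hy, h⟩
        exact ⟨a', a, b, hy, hx, h.symm⟩
      · rintro x y z ⟨a, a', b, rfl, rfl, h⟩ ⟨c, c', d, hc, rfl, h'⟩ hne hne'
        simp at hc
        obtain ⟨rfl, rfl⟩ := hc
        simp [Fin.ext_iff] at hne hne' ⊢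
        omega
      · intro B hB hc
        obtain ⟨-, b, g, hg⟩ := copy_sides n n₁ n₂ B hB hc
        obtain ⟨i, j, hij, he⟩ := pigeon n n₁ h g
        exact ⟨_, hg i, _, hg j, by simpa using hij, _, _, _, rfl, rfl, he⟩
    · refine bob_draws _ _ d (fun x y => ∃ (a a' : Fin n₂) (b : Fin n₁),
        x = s(Sum.inl b, Sum.inr a) ∧ y = s(Sum.inl b, Sum.inr a') ∧ (a : ℕ) / 2 = (a' : ℕ) / 2)
        ?_ ?_ ?_ hw
      · rintro x y ⟨a, a', b, hx, hy, h⟩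
        exact ⟨a', a, b, hy, hx, h.symm⟩
      · rintro x y z ⟨a, a', b, rfl, rfl, h⟩ ⟨c, c', d, hc, rfl, h'⟩ hne hne'
        simp at hc
        obtain ⟨rfl, rfl⟩ := hc
        simp [Fin.ext_iff] at hne hne' ⊢
        omega
      · intro B hB hc
        obtain ⟨⟨b, g, hg⟩, -⟩ := copy_sides n n₁ n₂ B hB hc
        obtain ⟨i, j, hij, he⟩ := pigeon n n₂ h g
        exact ⟨_, hg i, _, hg j, by simpa using hij, _, _, _, rfl, rfl, he⟩
  · intro h
    have hn1 : 2 * n + 1 ≤ n₁ := by omega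
    have hn2 : 2 * n + 1 ≤ n₂ := by omega
    let r₁ : Fin n → Bool → Fin n₁ := fun i c => ⟨1 + 2 * i + c.toNat, by
      have := i.2; have := c.toNat_le; omega⟩
    let r₂ : Fin n → Bool → Fin n₂ := fun i c => ⟨1 + 2 * i + c.toNat, by
      have := i.2; have := c.toNat_le; omega⟩
    have r₁i : ∀ i c j d, r₁ i c = r₁ j d → i = j ∧ c = d := by
      intro i c j d h
      simp only [r₁, Fin.ext_iff] at h ⊢
      cases c <;> cases d <;> simp at h ⊢ <;> omega
    have r₂i : ∀ i c j d, r₂ i c = r₂ j d → i = j ∧ c = d := by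
      intro i c j d h
      simp only [r₂, Fin.ext_iff] at h ⊢
      cases c <;> cases d <;> simp at h ⊢ <;> omega
    let u : Fin n₁ := ⟨0, h₁⟩
    let v : Fin n₂ := ⟨0, h₂⟩
    have hr₁ : ∀ i c, r₁ i c ≠ u := by
      intro i c h
      simp only [r₁, u, Fin.ext_iff] at h
      omega
    have hr₂ : ∀ i c, r₂ i c ≠ v := by
      intro i c h
      simp only [r₂, v, Fin.ext_iff] at h
      omega
    clear_value r₁ r₂ u v
    let p : Fin n ⊕ Fin n → Bool → Sym2 (Fin n₁ ⊕ Fin n₂) := fun i c =>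
      i.elim (fun i => s(Sum.inl u, Sum.inr (r₂ i c))) (fun i => s(Sum.inl (r₁ i c), Sum.inr v))
    let e0 : Sym2 (Fin n₁ ⊕ Fin n₂) := s(Sum.inl u, Sum.inr v)
    set G := completeBipartiteGraph (Fin n₁) (Fin n₂) with hG
    have h0 : e0 ∈ G.edgeSet := by simp [e0, hG]
    have hp : ∀ i c, p i c ∈ G.edgeSet := by
      rintro (i | i) c <;> simp [p, hG]
    have hinj : ∀ i c j d, p i c = p j d → i = j ∧ c = d := by
      rintro (i | i) c (j | j) d hpq <;> simp [p] at hpq ⊢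
      · exact r₂i _ _ _ _ hpq
      · exact hr₂ _ _ hpq.2
      · exact hr₁ _ _ hpq.1
      · exact r₁i _ _ _ _ hpq
    have hne : ∀ i c, p i c ≠ e0 := by
      rintro (i | i) c <;> simp [p, e0, hr₁, hr₂]
    have hcI : Fintype.card (Fin n ⊕ Fin n) = 2 * n := by simp; omega
    have hcard : 2 * Fintype.card (Fin n ⊕ Fin n) + 1 ≤ G.edgeSet.ncard := by
      have hinj' : Function.Injective
          (fun q : Fin n₁ × Fin n₂ =>
            (s(Sum.inl q.1, Sum.inr q.2) : Sym2 (Fin n₁ ⊕ Fin n₂))) := by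
        rintro ⟨a, b⟩ ⟨c, d⟩ hq
        simpa using hq
      have hsub : Set.range (fun q : Fin n₁ × Fin n₂ =>
            (s(Sum.inl q.1, Sum.inr q.2) : Sym2 (Fin n₁ ⊕ Fin n₂))) ⊆ G.edgeSet := by
        rintro _ ⟨q, rfl⟩
        simp [hG]
      have h3 := Set.ncard_le_ncard hsub (Set.toFinite _)
      rw [Set.ncard_range_of_injective hinj'] at h3
      simp at h3
      rw [hcI]
      nlinarith [Nat.mul_le_mul hn1 hn2]
    refine ⟨aliceStrat G e0 p, aliceStrat_valid G e0 p h0 hp, fun τ hτ => ?_⟩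
    obtain ⟨hm0, hget⟩ := alice_gets G e0 p h0 hp hinj hne hcard τ hτ
    rw [hcI] at hget hcard
    refine ⟨2 * n, hcard, ?_, ?_⟩
    · choose c hc using hget
      set B : Set (Sym2 (Fin n₁ ⊕ Fin n₂)) :=
        {e | ∃ i ≤ 2 * n, e = move (aliceStrat G e0 p) τ (2 * i)} with hB
      have hB0 : s(Sum.inl u, Sum.inr v) ∈ B := ⟨0, Nat.zero_le _, hm0.symm⟩
      have hB1 : ∀ i, s(Sum.inl u, Sum.inr (r₂ i (c (Sum.inl i)))) ∈ B := fun i => hc (Sum.inl i)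
      have hB2 : ∀ i, s(Sum.inl (r₁ i (c (Sum.inr i))), Sum.inr v) ∈ B := fun i => hc (Sum.inr i)
      clear_value B
      let f : Fin (n+1) ⊕ Fin (n+1) → Fin n₁ ⊕ Fin n₂ := fun x => x.elim
        (Fin.cases (Sum.inl u) (fun i => Sum.inr (r₂ i (c (Sum.inl i)))))
        (Fin.cases (Sum.inr v) (fun i => Sum.inl (r₁ i (c (Sum.inr i)))))
      have hf : Function.Injective f := by
        rintro (x | x) (y | y) <;> refine Fin.cases ?_ (fun i => ?_) x <;>
          refine Fin.cases ?_ (fun j => ?_) y <;> simp [f, hr₁, hr₂, fun i c => (hr₁ i c).symm, fun i c => (hr₂ i c).symm]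
        · exact fun h => (r₂i _ _ _ _ h).1
        · exact fun h => (r₁i _ _ _ _ h).1
      have key : ∀ a b, ((a = Sum.inl 0 ∧ ∃ i, b = Sum.inl i) ∨
          (a = Sum.inr 0 ∧ ∃ j, b = Sum.inr j) ∨ (a = Sum.inl 0 ∧ b = Sum.inr 0)) → a ≠ b →
          s(f a, f b) ∈ B := by
        rintro a b (⟨rfl, i, rfl⟩ | ⟨rfl, i, rfl⟩ | ⟨rfl, rfl⟩) hab
        · obtain ⟨i, rfl⟩ := Fin.exists_succ_eq.2 (show i ≠ 0 from fun h => hab (by rw [h]))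
          exact hB1 i
        · obtain ⟨i, rfl⟩ := Fin.exists_succ_eq.2 (show i ≠ 0 from fun h => hab (by rw [h]))
          rw [Sym2.eq_swap]
          exact hB2 i
        · exact hB0
      refine ⟨⟨f, hf⟩, fun a b hab => ?_⟩
      rw [doubleStar, SimpleGraph.fromRel_adj] at hab
      rcases hab with ⟨hab, h | h⟩
      · exact key a b h hab
      · rw [Sym2.eq_swap]
        exact key b a h hab.symm
    · intro hcopy
      have hsub : {e | ∃ i < 2 * n, e = move (aliceStrat G e0 p) τ (2 * i + 1)} =
          (((Finset.range (2 * n)).image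
            (fun i => move (aliceStrat G e0 p) τ (2 * i + 1)) : Finset _) : Set _) := by
        ext e
        simp [eq_comm]
      rw [hsub] at hcopy
      have h1 := copy_card n _ (Finset.finite_toSet _) hcopy
      rw [Set.ncard_coe_finset] at h1
      have h2 := Finset.card_image_le (s := Finset.range (2 * n))
        (f := fun i => move (aliceStrat G e0 p) τ (2 * i + 1))
      rw [Finset.card_range] at h2
      omega
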